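/- Let m, p be coprime positive integers and z, w ∈ ℂ. There exists r > 0 such that for every x ∈ ℂ with |x| < r the integral defining G_{m,p,z,w}(x) converges and G_{m,p,z,w}(x) = Σ_{k≥2} P_{m,p,z,w}(k) x^{2k}, where P_{m,p,z,w}(k) = Σ_{a+b=k, a≥1, b≥1} (-1)^b · (∫_0^{2π} cos^{2a}θ · sin^{2b}θ dθ) · Q_{m,p,z}(a) · Q_{m,p,w}(b). In particular G_{m,p,z,w} is even with a zero of order 4 at the origin, and for each fixed k the coefficient P_{m,p,z,w}(k) is a polynomial function of (z, w). -/

import Mathlib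

open Complex Filter MeasureTheory Metric Set Topology
open scoped Real Nat Classical

/-- The meromorphic function `F_{m,p,z}` of the paper, with the convention that
`sinh((2z+1)√(mp)x)/(2z+1)` is interpreted as its limit `√(mp)x` when `2z+1 = 0`. -/
noncomputable def Fmpz (m p : ℕ) (z x : ℂ) : ℂ :=
  ((if 2 * z + 1 = 0 then ((Real.sqrt ((m : ℝ) * (p : ℝ)) : ℂ) * x)
      else Complex.sinh ((2 * z + 1) * (Real.sqrt ((m : ℝ) * (p : ℝ)) : ℂ) * x) / (2 * z + 1))
    * Complex.sinh ((Real.sqrt ((m : ℝ) / (p : ℝ)) : ℂ) * x)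
    * Complex.sinh ((Real.sqrt ((p : ℝ) / (m : ℝ)) : ℂ) * x))
    / Complex.sinh ((Real.sqrt ((m : ℝ) * (p : ℝ)) : ℂ) * x)

/-- The power series `A` converges to `f` in a neighbourhood of the origin. -/
def HasPowerSeriesSum (f : ℂ → ℂ) (A : PowerSeries ℂ) : Prop :=
  ∀ᶠ y in 𝓝 (0 : ℂ), HasSum (fun n : ℕ => PowerSeries.coeff n A * y ^ n) (f y)

theorem HasPowerSeriesSum.mul {f g : ℂ → ℂ} {A B : PowerSeries ℂ}
    (hf : HasPowerSeriesSum f A) (hg : HasPowerSeriesSum g B) :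
    HasPowerSeriesSum (fun y => f y * g y) (A * B) := by
  filter_upwards [hf, hg] with y hfy hgy
  have h := hasSum_sum_range_mul_of_summable_norm hfy.summable.norm hgy.summable.norm
  rw [hfy.tsum_eq, hgy.tsum_eq] at h
  refine h.congr_fun fun n => ?_
  rw [PowerSeries.coeff_mul, Finset.sum_mul, Finset.Nat.sum_antidiagonal_eq_sum_range_succ_mk]
  refine Finset.sum_congr rfl fun k hk => ?_
  have hkn : k + (n - k) = n := by
    have := Finset.mem_range.1 hk
    omega
  calc _ = PowerSeries.coeff k A * PowerSeries.coeff (n - k) B * y ^ (k + (n - k)) := by rw [hkn]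
    _ = _ := by ring

theorem HasPowerSeriesSum.congr {f g : ℂ → ℂ} {A : PowerSeries ℂ}
    (hf : HasPowerSeriesSum f A) (hfg : f =ᶠ[𝓝 0] g) : HasPowerSeriesSum g A := by
  filter_upwards [hf, hfg] with y hfy hy
  rwa [← hy]

theorem HasPowerSeriesSum.unique {f : ℂ → ℂ} {A B : PowerSeries ℂ}
    (hA : HasPowerSeriesSum f A) (hB : HasPowerSeriesSum f B) : A = B := by
  have key : ∀ C : PowerSeries ℂ, HasPowerSeriesSum f C →
      HasFPowerSeriesAt f
        (FormalMultilinearSeries.ofScalars ℂ fun n => PowerSeries.coeff n C) 0 := by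
    intro C hC
    rw [hasFPowerSeriesAt_iff]
    filter_upwards [hC] with y hy
    simpa only [FormalMultilinearSeries.coeff_ofScalars, smul_eq_mul, zero_add, mul_comm] using hy
  ext n
  have h := congrArg (fun q => FormalMultilinearSeries.coeff q n)
    ((key A hA).eq_formalMultilinearSeries (key B hB))
  simpa only [FormalMultilinearSeries.coeff_ofScalars] using h

/-- The Taylor series of `x ↦ sinh (t * c * x) / t`. -/
noncomputable def sinhDivSeries (t c : ℂ) : PowerSeries ℂ :=
  PowerSeries.mk fun n => if Odd n then t ^ (n - 1) * c ^ n / (n ! : ℂ) else 0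

theorem hasSum_odd_iff {f : ℕ → ℂ} {a : ℂ} (hf : ∀ n, ¬ Odd n → f n = 0) :
    HasSum (fun k => f (2 * k + 1)) a ↔ HasSum f a := by
  have hinj : Function.Injective fun k : ℕ => 2 * k + 1 := fun a b h => by
    simpa using h
  exact hinj.hasSum_iff fun n hn => hf n fun ⟨k, hk⟩ => hn ⟨k, hk.symm⟩

theorem hasPowerSeriesSum_sinhDivSeries (t c : ℂ) :
    HasPowerSeriesSum
      (fun x => if t = 0 then c * x else Complex.sinh (t * c * x) / t) (sinhDivSeries t c) := by
  refine Eventually.of_forall fun x => ?_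
  rw [← hasSum_odd_iff]
  · by_cases ht : t = 0
    · subst ht
      convert hasSum_single (0 : ℕ) ?_ using 1
      · simp [sinhDivSeries]
      · intro k hk
        simp [sinhDivSeries, hk]
    · simp only [ht, if_false]
      refine ((Complex.hasSum_sinh (t * c * x)).div_const t).congr_fun fun k => ?_
      simp only [sinhDivSeries, PowerSeries.coeff_mk, odd_two_mul_add_one, if_true,
        Nat.add_sub_cancel]
      field_simp
      ring
  · intro n hn
    simp [sinhDivSeries, hn]

theorem hasPowerSeriesSum_sinh (c : ℂ) :
    HasPowerSeriesSum (fun x => Complex.sinh (c * x)) (sinhDivSeries 1 c) := by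
  simpa using hasPowerSeriesSum_sinhDivSeries 1 c

theorem exists_sinhDivSeries_eq_X_mul {c : ℂ} (hc : c ≠ 0) :
    ∃ U V : PowerSeries ℂ, sinhDivSeries 1 c = PowerSeries.X * U ∧ U * V = 1 := by
  have hX : PowerSeries.X ∣ sinhDivSeries 1 c := by
    rw [PowerSeries.X_dvd_iff]
    simp [sinhDivSeries, ← PowerSeries.coeff_zero_eq_constantCoeff_apply]
  obtain ⟨U, hU⟩ := hX
  have hU0 : PowerSeries.constantCoeff U = c := by
    have h := congrArg (PowerSeries.coeff 1) hU
    rw [← zero_add 1, PowerSeries.coeff_succ_X_mul] at h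
    simpa [sinhDivSeries] using h.symm
  exact ⟨U, U.invOfUnit (Units.mk0 c hc), hU, PowerSeries.mul_invOfUnit _ _ hU0⟩

theorem eventually_sinh_mul_ne_zero {c : ℂ} (hc : c ≠ 0) :
    ∀ᶠ x in 𝓝[≠] (0 : ℂ), Complex.sinh (c * x) ≠ 0 := by
  have h : HasDerivAt (fun x : ℂ => Complex.sinh (c * x)) c 0 := by
    simpa using ((hasDerivAt_id (0 : ℂ)).const_mul c).csinh
  exact h.eventually_ne hc

/-- The power series with even coefficients `q` and vanishing odd coefficients. -/
noncomputable def evenSeries (q : ℕ → ℂ) : PowerSeries ℂ :=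
  PowerSeries.mk fun n => if Even n then q (n / 2) else 0

theorem hasPowerSeriesSum_evenSeries {f : ℂ → ℂ} {q : ℕ → ℂ}
    (h : ∀ᶠ y in 𝓝 (0 : ℂ), HasSum (fun k : ℕ => q k * y ^ (2 * k)) (f y)) :
    HasPowerSeriesSum f (evenSeries q) := by
  filter_upwards [h] with y hy
  have hinj : Function.Injective fun k : ℕ => 2 * k := fun a b h => by
    simpa using h
  rw [← hinj.hasSum_iff]
  · simpa [Function.comp_def, evenSeries] using hy
  · intro n hn
    have : ¬ Even n := fun ⟨k, hk⟩ => hn ⟨k, by simp only; omega⟩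
    simp [evenSeries, this]

theorem Fmpz_mul_sinh_eventuallyEq {m p : ℕ} (hm : 0 < m) (hp : 0 < p) (z : ℂ) :
    (fun x => Fmpz m p z x * Complex.sinh ((Real.sqrt ((m : ℝ) * (p : ℝ)) : ℂ) * x)) =ᶠ[𝓝 0]
      fun x => (if 2 * z + 1 = 0 then (Real.sqrt ((m : ℝ) * (p : ℝ)) : ℂ) * x
          else Complex.sinh ((2 * z + 1) * (Real.sqrt ((m : ℝ) * (p : ℝ)) : ℂ) * x) / (2 * z + 1))
        * Complex.sinh ((Real.sqrt ((m : ℝ) / (p : ℝ)) : ℂ) * x)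
        * Complex.sinh ((Real.sqrt ((p : ℝ) / (m : ℝ)) : ℂ) * x) := by
  have hc : (Real.sqrt ((m : ℝ) * (p : ℝ)) : ℂ) ≠ 0 := by
    exact_mod_cast (Real.sqrt_pos.2 (by positivity)).ne'
  have h := eventually_sinh_mul_ne_zero hc
  rw [eventually_nhdsWithin_iff] at h
  filter_upwards [h] with x hx
  by_cases hx0 : x = 0
  · simp [hx0]
  · rw [Fmpz, div_mul_cancel₀ _ (hx hx0)]

theorem exists_polynomial_of_hasSum_Fmpz {m p : ℕ} (hm : 0 < m) (hp : 0 < p) (Q : ℂ → ℕ → ℂ)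
    (hQ : ∀ z : ℂ, ∀ᶠ y in 𝓝 (0 : ℂ),
      HasSum (fun k : ℕ => Q z k * y ^ (2 * k)) (Fmpz m p z y)) (k : ℕ) :
    ∃ q : Polynomial ℂ, ∀ z, Q z k = q.eval z := by
  set c : ℂ := (Real.sqrt ((m : ℝ) * (p : ℝ)) : ℂ) with hcdef
  have hc : c ≠ 0 := by
    rw [hcdef]
    exact_mod_cast (Real.sqrt_pos.2 (by positivity)).ne'
  set a : ℂ := (Real.sqrt ((m : ℝ) / (p : ℝ)) : ℂ)
  set b : ℂ := (Real.sqrt ((p : ℝ) / (m : ℝ)) : ℂ)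
  obtain ⟨U, V, hU, hUV⟩ := exists_sinhDivSeries_eq_X_mul hc
  have hseries : ∀ z, PowerSeries.X * evenSeries (Q z) =
      sinhDivSeries (2 * z + 1) c * (sinhDivSeries 1 a * sinhDivSeries 1 b * V) := by
    intro z
    have h : evenSeries (Q z) * sinhDivSeries 1 c =
        sinhDivSeries (2 * z + 1) c * sinhDivSeries 1 a * sinhDivSeries 1 b :=
      (((hasPowerSeriesSum_evenSeries (hQ z)).mul (hasPowerSeriesSum_sinh c)).congr
        (Fmpz_mul_sinh_eventuallyEq hm hp z)).unique
        (((hasPowerSeriesSum_sinhDivSeries _ c).mul (hasPowerSeriesSum_sinh a)).mul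
          (hasPowerSeriesSum_sinh b))
    rw [hU] at h
    calc _ = evenSeries (Q z) * (PowerSeries.X * U) * V := by
          linear_combination (-PowerSeries.X * evenSeries (Q z)) * hUV
      _ = _ := by rw [h]; ring
  refine ⟨∑ ij ∈ Finset.HasAntidiagonal.antidiagonal (2 * k + 1),
    (if Odd ij.1 then (2 * Polynomial.X + 1) ^ (ij.1 - 1) *
      Polynomial.C (c ^ ij.1 / (ij.1 ! : ℂ)) else 0) *
      Polynomial.C (PowerSeries.coeff ij.2 (sinhDivSeries 1 a * sinhDivSeries 1 b * V)),
    fun z => ?_⟩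
  have h := congrArg (PowerSeries.coeff (2 * k + 1)) (hseries z)
  rw [PowerSeries.coeff_succ_X_mul, PowerSeries.coeff_mul] at h
  rw [Polynomial.eval_finsetSum]
  convert h using 1
  · simp [evenSeries]
  · refine Finset.sum_congr rfl fun ij _ => ?_
    by_cases ho : Odd ij.1 <;> simp [sinhDivSeries, ho, mul_div_assoc]

theorem HasSum.antidiagonal {f : ℕ × ℕ → ℂ} {s : ℂ} (h : HasSum f s) :
    HasSum (fun n => ∑ ab ∈ Finset.HasAntidiagonal.antidiagonal n, f ab) s := by
  have h' := Finset.HasAntidiagonal.sigmaAntidiagonalEquivProd.hasSum_iff.2 h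
  refine h'.sigma fun n => ?_
  exact Finset.hasSum (Finset.HasAntidiagonal.antidiagonal n) f

theorem sum_antidiagonal_eq_sum_Ioo {f : ℕ → ℕ → ℂ} (h₁ : ∀ b, f 0 b = 0) (h₂ : ∀ a, f a 0 = 0)
    (n : ℕ) :
    ∑ ab ∈ Finset.HasAntidiagonal.antidiagonal n, f ab.1 ab.2 =
      ∑ a ∈ Finset.Ioo 0 n, f a (n - a) := by
  rw [Finset.Nat.sum_antidiagonal_eq_sum_range_succ]
  refine (Finset.sum_subset (fun a ha => ?_) fun a ha ha' => ?_).symm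
  · rw [Finset.mem_Ioo] at ha
    rw [Finset.mem_range]
    omega
  · rw [Finset.mem_range] at ha
    rw [Finset.mem_Ioo] at ha'
    obtain rfl | rfl : a = 0 ∨ a = n := by omega
    · exact h₁ _
    · rw [Nat.sub_self, h₂]

theorem integral_mul_cos_pow_mul_sin_pow (u v x : ℂ) (a b : ℕ) :
    ∫ θ in (0:ℝ)..(2 * Real.pi), (u * (x * (Real.cos θ : ℂ)) ^ (2 * a)) *
        (v * (Complex.I * x * (Real.sin θ : ℂ)) ^ (2 * b)) =
      (-1 : ℂ) ^ b *
        (((∫ θ in (0:ℝ)..(2 * Real.pi), Real.cos θ ^ (2 * a) * Real.sin θ ^ (2 * b)) : ℝ) : ℂ) *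
        u * v * x ^ (2 * (a + b)) := by
  have hI : Complex.I ^ (2 * b) = (-1) ^ b := by rw [pow_mul, Complex.I_sq]
  have h : ∀ θ : ℝ, (u * (x * (Real.cos θ : ℂ)) ^ (2 * a)) *
        (v * (Complex.I * x * (Real.sin θ : ℂ)) ^ (2 * b)) =
      ((-1 : ℂ) ^ b * u * v * x ^ (2 * (a + b))) *
        ((Real.cos θ ^ (2 * a) * Real.sin θ ^ (2 * b) : ℝ) : ℂ) := by
    intro θ
    rw [mul_pow, mul_pow, mul_pow, hI, Complex.ofReal_mul, Complex.ofReal_pow, Complex.ofReal_pow,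
      mul_add, pow_add]
    ring
  simp only [h]
  rw [intervalIntegral.integral_const_mul, intervalIntegral.integral_ofReal]
  ring

/-- Termwise integration of the product of two even power series, evaluated at `x cos θ` and
`i x sin θ`. -/
theorem hasSum_integral_mul_cos_sin {f g : ℂ → ℂ} {u v : ℕ → ℂ} {R : ℝ}
    (hf : ∀ y : ℂ, ‖y‖ < R → HasSum (fun k : ℕ => u k * y ^ (2 * k)) (f y))
    (hg : ∀ y : ℂ, ‖y‖ < R → HasSum (fun k : ℕ => v k * y ^ (2 * k)) (g y))
    {x : ℂ} (hx : ‖x‖ < R) :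
    Continuous (fun θ : ℝ =>
      f (x * (Real.cos θ : ℂ)) * g (Complex.I * x * (Real.sin θ : ℂ))) ∧
    HasSum (fun ab : ℕ × ℕ => (-1 : ℂ) ^ ab.2 *
        (((∫ θ in (0:ℝ)..(2 * Real.pi),
          Real.cos θ ^ (2 * ab.1) * Real.sin θ ^ (2 * ab.2)) : ℝ) : ℂ) *
        u ab.1 * v ab.2 * x ^ (2 * (ab.1 + ab.2)))
      (∫ θ in (0:ℝ)..(2 * Real.pi),
        f (x * (Real.cos θ : ℂ)) * g (Complex.I * x * (Real.sin θ : ℂ))) := by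
  have hcos : ∀ θ : ℝ, ‖x * (Real.cos θ : ℂ)‖ ≤ ‖x‖ := fun θ => by
    rw [norm_mul, Complex.norm_real]
    exact mul_le_of_le_one_right (norm_nonneg _) (Real.abs_cos_le_one θ)
  have hsin : ∀ θ : ℝ, ‖Complex.I * x * (Real.sin θ : ℂ)‖ ≤ ‖x‖ := fun θ => by
    rw [norm_mul, norm_mul, Complex.norm_I, one_mul, Complex.norm_real]
    exact mul_le_of_le_one_right (norm_nonneg _) (Real.abs_sin_le_one θ)
  let T : ℕ × ℕ → ℝ → ℂ := fun ab θ =>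
    (u ab.1 * (x * (Real.cos θ : ℂ)) ^ (2 * ab.1)) *
      (v ab.2 * (Complex.I * x * (Real.sin θ : ℂ)) ^ (2 * ab.2))
  let B : ℕ × ℕ → ℝ := fun ab =>
    ‖(u ab.1 * x ^ (2 * ab.1)) * (v ab.2 * x ^ (2 * ab.2))‖
  have hB : Summable B :=
    Summable.mul_norm (f := fun a => u a * x ^ (2 * a)) (g := fun b => v b * x ^ (2 * b))
      (hf x hx).summable.norm (hg x hx).summable.norm
  have hTB : ∀ ab θ, ‖T ab θ‖ ≤ B ab := fun ab θ => by
    simp only [T, B, norm_mul (u _), norm_mul (v _), norm_mul (_ * _), norm_pow]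
    gcongr
    · exact hcos θ
    · simpa only [norm_mul] using hsin θ
  have hTc : ∀ ab, Continuous (T ab) := fun ab => by
    simp only [T]
    fun_prop
  have hT : ∀ θ, HasSum (fun ab => T ab θ)
      (f (x * (Real.cos θ : ℂ)) * g (Complex.I * x * (Real.sin θ : ℂ))) := fun θ =>
    HasSum.mul (f := fun a => u a * (x * (Real.cos θ : ℂ)) ^ (2 * a))
      (g := fun b => v b * (Complex.I * x * (Real.sin θ : ℂ)) ^ (2 * b))
      (hf _ ((hcos θ).trans_lt hx)) (hg _ ((hsin θ).trans_lt hx))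
      (hB.of_norm_bounded fun ab => hTB ab θ)
  constructor
  · simp only [← fun θ => (hT θ).tsum_eq]
    exact continuous_tsum hTc hB hTB
  · have h := intervalIntegral.hasSum_integral_of_dominated_convergence (μ := volume)
      (a := 0) (b := 2 * Real.pi) (F := T) (fun ab _ => B ab)
      (fun ab => (hTc ab).aestronglyMeasurable)
      (fun ab => Eventually.of_forall fun θ _ => hTB ab θ)
      (Eventually.of_forall fun _ _ => hB) intervalIntegrable_const
      (Eventually.of_forall fun θ _ => hT θ)
    exact h.congr_fun fun ab => (integral_mul_cos_pow_mul_sin_pow _ _ x ab.1 ab.2).symm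

theorem exists_mvPolynomial_sum_mul {ι : Type*} (s : Finset ι) (C : ι → ℂ) (f g : ι → ℂ → ℂ)
    (hf : ∀ i, ∃ q : Polynomial ℂ, ∀ z, f i z = q.eval z)
    (hg : ∀ i, ∃ q : Polynomial ℂ, ∀ z, g i z = q.eval z) :
    ∃ q : MvPolynomial (Fin 2) ℂ, ∀ z w : ℂ,
      ∑ i ∈ s, C i * f i z * g i w = MvPolynomial.eval ![z, w] q := by
  choose A hA using hf
  choose B hB using hg
  have heval : ∀ (q : Polynomial ℂ) (j : Fin 2) (e : Fin 2 → ℂ),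
      MvPolynomial.eval e (Polynomial.aeval (MvPolynomial.X j) q) = q.eval (e j) := by
    intro q j e
    rw [← MvPolynomial.coe_aeval_eq_eval, RingHom.coe_coe, ← Polynomial.aeval_algHom_apply,
      MvPolynomial.aeval_X, Polynomial.coe_aeval_eq_eval]
  refine ⟨∑ i ∈ s, MvPolynomial.C (C i) * Polynomial.aeval (MvPolynomial.X 0) (A i) *
    Polynomial.aeval (MvPolynomial.X 1) (B i), fun z w => ?_⟩
  simp [heval, hA, hB]

/-- Near `0`, `G_{m,p,z,w}(x) = ∫_0^{2π} F_{m,p,z}(x cos θ) F_{m,p,w}(i x sin θ) dθ`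
is defined and has the Taylor expansion `Σ_{k≥2} P_{m,p,z,w}(k) x^{2k}`, where
`P_{m,p,z,w}(k) = Σ_{a+b=k, a,b≥1} (-1)^b (∫_0^{2π} cos^{2a}θ sin^{2b}θ dθ) Q_z(a) Q_w(b)`;
moreover each `P_{m,p,z,w}(k)` is a polynomial function of `(z,w)`. -/
theorem stmt5 (m p : ℕ) (hm : 0 < m) (hp : 0 < p) (hcop : Nat.Coprime m p)
    (Q : ℂ → ℕ → ℂ) (hQ0 : ∀ z : ℂ, Q z 0 = 0)
    (hQ : ∀ z : ℂ, ∀ᶠ y in 𝓝 (0 : ℂ),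
      HasSum (fun k : ℕ => Q z k * y ^ (2 * k)) (Fmpz m p z y))
    (P : ℂ → ℂ → ℕ → ℂ)
    (hP : ∀ (z w : ℂ) (k : ℕ), P z w k =
      ∑ a ∈ Finset.Ioo 0 k, (-1 : ℂ) ^ (k - a) *
        (((∫ θ in (0:ℝ)..(2 * Real.pi), Real.cos θ ^ (2 * a) * Real.sin θ ^ (2 * (k - a))) : ℝ) : ℂ) *
        Q z a * Q w (k - a)) :
    (∀ z w : ℂ, ∃ r : ℝ, 0 < r ∧ ∀ x : ℂ, ‖x‖ < r →
      IntervalIntegrable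
        (fun θ : ℝ => Fmpz m p z (x * (Real.cos θ : ℂ)) * Fmpz m p w (Complex.I * x * (Real.sin θ : ℂ)))
        volume 0 (2 * Real.pi) ∧
      HasSum (fun k : ℕ => P z w (k + 2) * x ^ (2 * (k + 2)))
        (∫ θ in (0:ℝ)..(2 * Real.pi),
          Fmpz m p z (x * (Real.cos θ : ℂ)) * Fmpz m p w (Complex.I * x * (Real.sin θ : ℂ)))) ∧
    (∀ k : ℕ, ∃ q : MvPolynomial (Fin 2) ℂ, ∀ z w : ℂ,
      P z w k = MvPolynomial.eval ![z, w] q) := by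
  refine ⟨fun z w => ?_, fun k => ?_⟩
  · obtain ⟨R, hR, hRzw⟩ := Metric.eventually_nhds_iff.1 ((hQ z).and (hQ w))
    simp only [dist_zero_right] at hRzw
    refine ⟨R, hR, fun x hx => ?_⟩
    obtain ⟨hcont, hsum⟩ := hasSum_integral_mul_cos_sin (fun y hy => (hRzw hy).1)
      (fun y hy => (hRzw hy).2) hx
    refine ⟨hcont.intervalIntegrable _ _, ?_⟩
    have hP' : ∀ k, P z w k * x ^ (2 * k) =
        ∑ ab ∈ Finset.HasAntidiagonal.antidiagonal k, (-1 : ℂ) ^ ab.2 *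
          (((∫ θ in (0:ℝ)..(2 * Real.pi),
            Real.cos θ ^ (2 * ab.1) * Real.sin θ ^ (2 * ab.2)) : ℝ) : ℂ) *
          Q z ab.1 * Q w ab.2 * x ^ (2 * (ab.1 + ab.2)) := by
      intro k
      rw [sum_antidiagonal_eq_sum_Ioo (f := fun a b => (-1 : ℂ) ^ b *
          (((∫ θ in (0:ℝ)..(2 * Real.pi), Real.cos θ ^ (2 * a) * Real.sin θ ^ (2 * b)) : ℝ) : ℂ) *
          Q z a * Q w b * x ^ (2 * (a + b))) (by simp [hQ0]) (by simp [hQ0]), hP, Finset.sum_mul]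
      refine Finset.sum_congr rfl fun a ha => ?_
      rw [Nat.add_sub_cancel' (Finset.mem_Ioo.1 ha).2.le]
    refine (hasSum_nat_add_iff (f := fun k => P z w k * x ^ (2 * k)) 2).2 ?_
    have hlow : ∑ k ∈ Finset.range 2, P z w k * x ^ (2 * k) = 0 := by
      simp [Finset.sum_range_succ, hP, show Finset.Ioo 0 1 = (∅ : Finset ℕ) from rfl]
    rw [hlow, add_zero]
    exact hsum.antidiagonal.congr_fun hP'
  · simp only [hP]
    exact exists_mvPolynomial_sum_mul _ _ (fun a z => Q z a) (fun a w => Q w (k - a))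
      (fun a => exists_polynomial_of_hasSum_Fmpz hm hp Q hQ a)
      (fun a => exists_polynomial_of_hasSum_Fmpz hm hp Q hQ (k - a))
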